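/- Let p > 3 be a prime with p ≡ 1 (mod 4), and let a, b be integers with Legendre symbol (−ab/p) = −1. Then for every real number x, C_p(a,b,x) = (−1)^{(p+3)/4}·δ(ab,p)·2^{(p−1)/2}/√p. -/

import Mathlib

/-- `deltaP p c = δ(c,p)`, defined for `p ≡ 1 (mod 4)` and `p ∤ c` to be `1` if
`c^{(p−1)/4} ≡ ((p−1)/2)! (mod p)` and `−1` otherwise. -/
def deltaP (p : ℕ) (c : ℤ) : ℤ :=
  if (c : ZMod p) ^ ((p - 1) / 4) = (Nat.factorial ((p - 1) / 2) : ZMod p) then 1 else -1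

open Finset Polynomial in
lemma my_cauchy_aux {n : ℕ} (G : Fin n → ℂ[X]) (hG : ∀ k, (G k).natDegree < n) (u : Fin n → ℂ) :
    (Matrix.of fun j k => (G k).eval (u j)) =
      Matrix.vandermonde u * Matrix.of fun (i k : Fin n) => (G k).coeff i := by
  ext j k
  simp only [Matrix.of_apply, Matrix.mul_apply, Matrix.vandermonde_apply]
  rw [Polynomial.eval_eq_sum_range' (hG k), Finset.sum_range]
  exact Finset.sum_congr rfl fun i _ => mul_comm _ _

open Finset Polynomial in
lemma my_cauchy {n : ℕ} (u v : Fin n → ℂ) (hv : Function.Injective v) (huv : ∀ j k, u j ≠ v k) :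
    (Matrix.of fun j k => (u j - v k)⁻¹).det * ∏ j, ∏ k, (u j - v k) =
      ∏ i, ∏ j ∈ Ioi i, ((u j - u i) * (v i - v j)) := by
  classical
  set G : Fin n → ℂ[X] := fun k => ∏ i ∈ ({k} : Finset (Fin n))ᶜ, (X - C (v i)) with hGdef
  have hG : ∀ k, (G k).natDegree < n := by
    intro k
    simp only [hGdef]
    rw [natDegree_prod_of_monic _ _ (fun i _ => monic_X_sub_C _)]
    simp [Finset.card_compl]
    exact k.pos
  have h1 := congrArg Matrix.det (my_cauchy_aux G hG u)
  have h2 := congrArg Matrix.det (my_cauchy_aux G hG v)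
  rw [Matrix.det_mul] at h1 h2
  have e1 : (Matrix.of fun j k => (G k).eval (u j)) =
      Matrix.of fun j k => (∏ i, (u j - v i)) * (Matrix.of fun j k => (u j - v k)⁻¹) j k := by
    ext j k
    simp only [Matrix.of_apply, hGdef, eval_prod, eval_sub, eval_X, eval_C]
    rw [← Finset.prod_compl_mul_prod ({k} : Finset (Fin n)), Finset.prod_singleton,
      mul_assoc, mul_inv_cancel₀ (sub_ne_zero.2 (huv j k)), mul_one]
  rw [e1, Matrix.det_mul_column] at h1
  have e2 : (Matrix.of fun j k => (G k).eval (v j)) =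
      Matrix.diagonal fun k => ∏ i ∈ ({k} : Finset (Fin n))ᶜ, (v k - v i) := by
    ext j k
    simp only [Matrix.of_apply, hGdef, eval_prod, eval_sub, eval_X, eval_C, Matrix.diagonal_apply]
    split_ifs with h
    · subst h; rfl
    · exact Finset.prod_eq_zero (i := j) (by simpa using h) (by simp)
  rw [e2, Matrix.det_diagonal, ← Finset.prod_prod_Ioi_mul_eq_prod_prod_off_diag
    (fun i k => v k - v i)] at h2
  have hV : (Matrix.vandermonde v).det ≠ 0 := Matrix.det_vandermonde_ne_zero_iff.2 hv
  rw [mul_comm, h1]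
  simp only [Finset.prod_mul_distrib] at h2 ⊢
  rw [Matrix.det_vandermonde] at h1 h2 hV ⊢
  congr 1
  apply mul_left_cancel₀ hV
  rw [← h2, mul_comm]

lemma my_affine {n : ℕ} (A : Matrix (Fin n) (Fin n) ℂ) (hA : A.det ≠ 0) (t : ℂ)
    (ht : t ≠ 0) (h : (Matrix.of fun j k => t + A j k).det = A.det) (s : ℂ) :
    (Matrix.of fun j k => s + A j k).det = A.det := by
  have key : ∃ c : ℂ, ∀ s : ℂ, (Matrix.of fun j k => s + A j k).det = A.det * (1 + s * c) := by
    refine ⟨∑ i, ∑ j, A⁻¹ i j, fun s => ?_⟩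
    have := Matrix.det_add_replicateCol_mul_replicateRow (ι := Unit) (A := A) hA.isUnit
      (fun _ => s) (fun _ => 1)
    have e : (A + (Matrix.replicateCol Unit (fun _ : Fin n => s)) *
        (Matrix.replicateRow Unit (fun _ : Fin n => (1:ℂ)))) =
      Matrix.of fun j k => s + A j k := by
      ext j k
      simp [Matrix.mul_apply, add_comm]
    rw [e] at this
    rw [this]
    congr 1
    rw [Matrix.det_unique]
    simp only [Matrix.add_apply, Matrix.one_apply_eq, Matrix.mul_apply, Matrix.replicateRow_apply,
      Matrix.replicateCol_apply, one_mul]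
    congr 1
    rw [← Finset.sum_mul, Finset.sum_comm, mul_comm]
  obtain ⟨c, hc⟩ := key
  rw [hc] at h
  have : c = 0 := by
    have h1 : A.det * (t * c) = 0 := by linear_combination h
    simpa [hA, ht] using h1
  rw [hc, this]; ring

section Basics
variable {p : ℕ} [Fact p.Prime]

lemma my_cast_inj {n : ℕ} (hpn : p = 2 * n + 1) (i j : Fin n)
    (h : (((i : ℕ) + 1 : ℕ) : ZMod p) ^ 2 = (((j : ℕ) + 1 : ℕ) : ZMod p) ^ 2) : i = j := by
  have hi := i.2
  have hj := j.2
  rcases sq_eq_sq_iff_eq_or_eq_neg.1 h with h | h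
  · have := (ZMod.natCast_eq_natCast_iff' _ _ _).1 h
    rw [Nat.mod_eq_of_lt (by omega), Nat.mod_eq_of_lt (by omega)] at this
    ext; omega
  · have h' : ((((i : ℕ) + 1) + ((j : ℕ) + 1) : ℕ) : ZMod p) = 0 := by
      rw [Nat.cast_add, h]; ring
    rw [ZMod.natCast_eq_zero_iff] at h'
    have := Nat.le_of_dvd (by omega) h'
    omega

lemma my_cast_ne {n : ℕ} (hpn : p = 2 * n + 1) (i : Fin n) :
    (((i : ℕ) + 1 : ℕ) : ZMod p) ≠ 0 := by
  have hi := i.2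
  intro h'
  rw [ZMod.natCast_eq_zero_iff] at h'
  have := Nat.le_of_dvd (by omega) h'
  omega

/-- sum over residues -/
lemma my_split0 {n : ℕ} (hpn : p = 2 * n + 1) (A B : ZMod p)
    (hAB : quadraticChar (ZMod p) (-(A * B)) = -1) (F : ZMod p → ℝ) :
    ∑ x, F x = F 0 + (∑ j : Fin n, F (A * (((j : ℕ) + 1 : ℕ) : ZMod p) ^ 2)
      + ∑ k : Fin n, F (-B * (((k : ℕ) + 1 : ℕ) : ZMod p) ^ 2)) := by
  classical
  have hns := quadraticChar_neg_one_iff_not_isSquare.1 hAB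
  have hA : A ≠ 0 := by rintro rfl; simp at hns
  have hB : B ≠ 0 := by rintro rfl; simp at hns
  let e : Option (Fin n ⊕ Fin n) → ZMod p := fun o => o.elim 0
    (Sum.elim (fun j => A * (((j : ℕ) + 1 : ℕ) : ZMod p) ^ 2)
      (fun k => -B * (((k : ℕ) + 1 : ℕ) : ZMod p) ^ 2))
  have hXY : ∀ j k : Fin n, A * (((j : ℕ) + 1 : ℕ) : ZMod p) ^ 2 ≠
      -B * (((k : ℕ) + 1 : ℕ) : ZMod p) ^ 2 := by
    intro j k h
    apply hns
    have hk := my_cast_ne hpn k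
    refine ⟨A * (((j : ℕ) + 1 : ℕ) : ZMod p) / (((k : ℕ) + 1 : ℕ) : ZMod p), ?_⟩
    field_simp
    linear_combination -h
  have hinj : Function.Injective e := by
    rintro (_ | i | i) (_ | j | j) h <;>
      simp only [e, Option.elim, Sum.elim_inl, Sum.elim_inr] at h
    · rfl
    · exact absurd h.symm (mul_ne_zero hA (pow_ne_zero _ (my_cast_ne hpn j)))
    · exact absurd h.symm (mul_ne_zero (neg_ne_zero.2 hB) (pow_ne_zero _ (my_cast_ne hpn j)))
    · exact absurd h (mul_ne_zero hA (pow_ne_zero _ (my_cast_ne hpn i)))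
    · rw [my_cast_inj hpn i j (mul_left_cancel₀ hA h)]
    · exact absurd h (hXY i j)
    · exact absurd h (mul_ne_zero (neg_ne_zero.2 hB) (pow_ne_zero _ (my_cast_ne hpn i)))
    · exact absurd h.symm (hXY j i)
    · rw [my_cast_inj hpn i j (mul_left_cancel₀ (neg_ne_zero.2 hB) h)]
  have hbij : Function.Bijective e := by
    rw [Fintype.bijective_iff_injective_and_card]
    refine ⟨hinj, ?_⟩
    simp [ZMod.card]; omega
  rw [← hbij.sum_comp, Fintype.sum_option, Fintype.sum_sum_type]
  simp [e]

lemma my_split1 {n : ℕ} (hpn : p = 2 * n + 1) (A B : ZMod p)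
    (hAB : quadraticChar (ZMod p) (-(A * B)) = -1) (h : ZMod p → ℝ) :
    ∑ x, (quadraticChar (ZMod p) x : ℝ) * h x = (quadraticChar (ZMod p) A : ℝ) *
     (∑ j : Fin n, h (A * (((j : ℕ) + 1 : ℕ) : ZMod p) ^ 2)
      - ∑ k : Fin n, h (-B * (((k : ℕ) + 1 : ℕ) : ZMod p) ^ 2)) := by
  rw [my_split0 hpn A B hAB]
  have hns := quadraticChar_neg_one_iff_not_isSquare.1 hAB
  have hA : A ≠ 0 := by rintro rfl; simp at hns
  have hB : quadraticChar (ZMod p) (-B) = - quadraticChar (ZMod p) A := by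
    have h1 := quadraticChar_sq_one hA
    have : -(A * B) = A * (-B) := by ring
    rw [this, map_mul] at hAB
    linear_combination (-quadraticChar (ZMod p) (-B)) * h1 + quadraticChar (ZMod p) A * hAB
  simp only [map_mul, quadraticChar_sq_one' (my_cast_ne hpn _), mul_one, hB, ← Finset.mul_sum]
  simp
  ring

lemma my_jac (hp2 : p ≠ 2) (d : ZMod p) (hd : d ≠ 0) :
    ∑ y, quadraticChar (ZMod p) y * quadraticChar (ZMod p) (y + d) = -1 := by
  have hc : ringChar (ZMod p) ≠ 2 := by rwa [ZMod.ringChar_zmod_n]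
  have hne := quadraticChar_ne_one hc
  have hj := jacobiSum_nontrivial_inv hne
  rw [(quadraticChar_isQuadratic (ZMod p)).inv, jacobiSum] at hj
  have e : Function.Bijective (fun x : ZMod p => -d * x) :=
    (Equiv.mulLeft₀ (-d) (neg_ne_zero.2 hd)).bijective
  rw [← e.sum_comp]
  have : ∀ x : ZMod p, quadraticChar (ZMod p) (-d * x) * quadraticChar (ZMod p) (-d * x + d) =
    quadraticChar (ZMod p) (-1) * (quadraticChar (ZMod p) x * quadraticChar (ZMod p) (1 - x)) := by
    intro x
    have h1 := quadraticChar_sq_one hd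
    have e1 : -d * x = (-1) * d * x := by ring
    have e2 : (-1) * d * x + d = d * (1 - x) := by ring
    rw [e1, e2]
    simp only [map_mul]
    linear_combination (quadraticChar (ZMod p) (-1) * (quadraticChar (ZMod p) x *
      quadraticChar (ZMod p) (1 - x))) * h1
  simp only [this, ← Finset.mul_sum, hj]
  have := quadraticChar_sq_one (F := ZMod p) (a := -1) (by simp)
  linear_combination -this

end Basics

section Norms
variable {p : ℕ} [Fact p.Prime]

/-- log distance -/
noncomputable def myL (p : ℕ) [Fact p.Prime] (d : ZMod p) : ℝ :=
  Real.log ‖(ZMod.stdAddChar d : ℂ) - 1‖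

lemma my_norm_psi (x : ZMod p) : ‖(ZMod.stdAddChar x : ℂ)‖ = 1 := by
  rw [ZMod.stdAddChar_apply]; exact Circle.norm_coe _

lemma myL_sub (x y : ZMod p) :
    Real.log ‖(ZMod.stdAddChar x : ℂ) - ZMod.stdAddChar y‖ = myL p (x - y) := by
  have : (ZMod.stdAddChar x : ℂ) - ZMod.stdAddChar y =
      ZMod.stdAddChar y * (ZMod.stdAddChar (x - y) - 1) := by
    rw [mul_sub, ← AddChar.map_add_eq_mul]; simp
  rw [this, norm_mul, my_norm_psi, one_mul, myL]

lemma myL_symm (x y : ZMod p) : myL p (x - y) = myL p (y - x) := by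
  rw [← myL_sub, ← myL_sub, norm_sub_rev]

lemma myL_zero : myL p 0 = 0 := by simp [myL]

lemma my_zsum (F : ZMod p → ℝ) : ∑ x, F x = ∑ i ∈ Finset.range p, F (i : ZMod p) := by
  refine Finset.sum_bij' (fun x _ => x.val) (fun i _ => (i : ZMod p)) ?_ ?_ ?_ ?_ ?_
  · intro x _; simpa using ZMod.val_lt x
  · intro _ _; simp
  · intro x _; simp
  · intro i hi; exact ZMod.val_cast_of_lt (by simpa using hi)
  · intro x _; simp

lemma my_psi_prim : IsPrimitiveRoot (ZMod.stdAddChar (1 : ZMod p) : ℂ) p := by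
  have := ZMod.stdAddChar_coe (N := p) 1
  simp only [Int.cast_one, mul_one] at this
  rw [this]
  exact Complex.isPrimitiveRoot_exp p (Fact.out : p.Prime).ne_zero

lemma my_psi_nat (k : ℕ) : (ZMod.stdAddChar (k : ZMod p) : ℂ) = (ZMod.stdAddChar (1 : ZMod p)) ^ k := by
  rw [← AddChar.map_nsmul_eq_pow]; simp

lemma myL_sum : ∑ d, myL p d = Real.log p := by
  rw [my_zsum]
  obtain ⟨m, hm⟩ : ∃ m, p = m + 1 := ⟨p - 1, by have := (Fact.out : p.Prime).pos; omega⟩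
  have h1 : IsPrimitiveRoot (ZMod.stdAddChar (1 : ZMod p) : ℂ) (m + 1) := by
    rw [← hm]; exact my_psi_prim
  have h2 := h1.prod_one_sub_pow_eq_order
  have hr : Finset.range p = Finset.range (m + 1) := by rw [← hm]
  rw [hr, Finset.sum_range_succ']
  simp only [Nat.cast_zero, myL_zero, add_zero]
  have h3 := congrArg (fun z : ℂ => Real.log ‖z‖) h2
  simp only [norm_prod] at h3
  rw [Real.log_prod] at h3
  · have : ((m : ℂ) + 1) = ((p : ℝ) : ℂ) := by rw [hm]; push_cast; ring
    rw [this, Complex.norm_real, Real.norm_of_nonneg (by positivity)] at h3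
    rw [← h3]
    refine Finset.sum_congr rfl fun k _ => ?_
    rw [myL, my_psi_nat, norm_sub_rev]
  · intro k hk
    rw [norm_ne_zero_iff, sub_ne_zero]
    intro h
    have := h1.dvd_of_pow_eq_one _ h.symm
    have := Nat.le_of_dvd (by omega) this
    simp at hk; omega

lemma my_halfsum {n : ℕ} (hpn : p = 2 * n + 1) (F : ZMod p → ℝ) :
    ∑ x, F x = F 0 + ∑ k : Fin n, (F (((k : ℕ) + 1 : ℕ) : ZMod p) + F (-(((k : ℕ) + 1 : ℕ) : ZMod p))) := by
  rw [my_zsum]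
  have : Finset.range p = Finset.range (2 * n + 1) := by rw [hpn]
  rw [this, Finset.sum_range_succ', two_mul, Finset.sum_range_add,
    ← Finset.sum_range_reflect (fun x => F ((n + x + 1 : ℕ) : ZMod p)), add_comm,
    Finset.sum_add_distrib, Finset.sum_range, Finset.sum_range]
  simp only [Nat.cast_zero]
  congr 2
  refine Finset.sum_congr rfl fun k _ => ?_
  congr 1
  have hk := k.2
  rw [eq_neg_iff_add_eq_zero, ← Nat.cast_add, ZMod.natCast_eq_zero_iff]
  have : n + (n - 1 - (k : ℕ)) + 1 + ((k : ℕ) + 1) = p := by omega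
  rw [this]

lemma my_P {n : ℕ} (hpn : p = 2 * n + 1) :
    ∏ k : Fin n, ((ZMod.stdAddChar (((k : ℕ) + 1 : ℕ) : ZMod p) : ℂ) -
      ZMod.stdAddChar (-(((k : ℕ) + 1 : ℕ) : ZMod p))) = Complex.I ^ n * (Real.sqrt p : ℂ) := by
  have hp0 : (0 : ℝ) < p := by exact_mod_cast (Fact.out : p.Prime).pos
  have hfac : ∀ k : Fin n, (ZMod.stdAddChar (((k : ℕ) + 1 : ℕ) : ZMod p) : ℂ) -
      ZMod.stdAddChar (-(((k : ℕ) + 1 : ℕ) : ZMod p)) =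
      Complex.I * ((2 * Real.sin (2 * Real.pi * ((k : ℕ) + 1) / p) : ℝ) : ℂ) := by
    intro k
    have h1 := ZMod.stdAddChar_coe (N := p) (((k : ℕ) : ℤ) + 1)
    have h2 := ZMod.stdAddChar_coe (N := p) (-(((k : ℕ) : ℤ) + 1))
    push_cast at h1 h2 ⊢
    rw [h1, h2, Complex.sin]
    have e1 : Complex.exp (2 * Real.pi * Complex.I * ((k : ℕ) + 1) / p) =
      Complex.exp (2 * Real.pi * ((k : ℕ) + 1) / p * Complex.I) := by congr 1; ring
    have e2 : Complex.exp (2 * Real.pi * Complex.I * (-1 + -(k : ℕ)) / p) =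
      Complex.exp (-(2 * Real.pi * ((k : ℕ) + 1) / p) * Complex.I) := by congr 1; ring
    rw [neg_add_rev, e1, e2]
    linear_combination ((Complex.exp (2 * Real.pi * ((k : ℕ) + 1) / p * Complex.I)) -
      Complex.exp (-(2 * Real.pi * ((k : ℕ) + 1) / p) * Complex.I)) * Complex.I_sq
  have hpos : ∀ k : Fin n, 0 < 2 * Real.sin (2 * Real.pi * ((k : ℕ) + 1) / p) := by
    intro k
    have hk : (((k : ℕ) : ℝ) + 1) * 2 < p := by
      have := k.2
      have h3 : ((k : ℕ) + 1) * 2 < p := by omega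
      exact_mod_cast h3
    have := Real.pi_pos
    refine mul_pos two_pos (Real.sin_pos_of_pos_of_lt_pi (by positivity) ?_)
    rw [div_lt_iff₀ hp0]
    nlinarith
  simp only [hfac]
  rw [Finset.prod_mul_distrib, Finset.prod_const, Finset.card_univ, Fintype.card_fin,
    ← Complex.ofReal_prod]
  congr 2
  have hPpos : 0 < ∏ k : Fin n, 2 * Real.sin (2 * Real.pi * ((k : ℕ) + 1) / p) :=
    Finset.prod_pos fun k _ => hpos k
  apply Real.log_injOn_pos hPpos (Real.sqrt_pos.2 hp0)
  rw [Real.log_sqrt hp0.le, ← myL_sum, Real.log_prod (fun k _ => (hpos k).ne')]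
  have h2 : (2 : ZMod p) ≠ 0 := by
    intro h
    have : ((2 : ℕ) : ZMod p) = 0 := by exact_mod_cast h
    rw [ZMod.natCast_eq_zero_iff] at this
    have hh := Nat.le_of_dvd (by omega) this
    have h3 := (Fact.out : p.Prime).two_le
    omega
  have e : Function.Bijective (fun x : ZMod p => 2 * x) :=
    (Equiv.mulLeft₀ 2 h2).bijective
  rw [← e.sum_comp, my_halfsum hpn, mul_zero, myL_zero, zero_add, eq_div_iff two_ne_zero,
    Finset.sum_mul]
  refine Finset.sum_congr rfl fun k _ => ?_
  have h3 : Real.log (2 * Real.sin (2 * Real.pi * ((k : ℕ) + 1) / p)) =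
      myL p ((((k : ℕ) + 1 : ℕ) : ZMod p) - -(((k : ℕ) + 1 : ℕ) : ZMod p)) := by
    rw [← myL_sub, hfac k, norm_mul, Complex.norm_I, one_mul, Complex.norm_real,
      Real.norm_of_nonneg (hpos k).le]
  have h4 := myL_symm (((k : ℕ) + 1 : ℕ) : ZMod p) (-(((k : ℕ) + 1 : ℕ) : ZMod p))
  have e3 : (2 : ZMod p) * (((k : ℕ) + 1 : ℕ) : ZMod p) =
    (((k : ℕ) + 1 : ℕ) : ZMod p) - -(((k : ℕ) + 1 : ℕ) : ZMod p) := by ring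
  have e4 : (2 : ZMod p) * -(((k : ℕ) + 1 : ℕ) : ZMod p) =
    -(((k : ℕ) + 1 : ℕ) : ZMod p) - (((k : ℕ) + 1 : ℕ) : ZMod p) := by ring
  rw [h3, e3, e4, ← h4]; ring

/-- the character sum -/
lemma my_charsum (hp2 : p ≠ 2) :
    ∑ x, (quadraticChar (ZMod p) x : ℝ) * ∑ y, (quadraticChar (ZMod p) y : ℝ) * myL p (x - y) =
      - Real.log p := by
  have h1 : ∀ d : ZMod p, ∑ y, (quadraticChar (ZMod p) y : ℝ) *
      ((quadraticChar (ZMod p) (y + d) : ℝ) * myL p d) = - myL p d := by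
    intro d
    by_cases hd : d = 0
    · subst hd; simp [myL_zero]
    · have := congrArg (Int.cast : ℤ → ℝ) (my_jac hp2 d hd)
      push_cast at this
      simp only [← mul_assoc]
      rw [← Finset.sum_mul, this]; ring
  simp only [Finset.mul_sum]
  rw [Finset.sum_comm, ← myL_sum, ← Finset.sum_neg_distrib]
  simp only [← h1]
  conv_rhs => rw [Finset.sum_comm]
  refine Finset.sum_congr rfl fun y _ => ?_
  rw [← (Equiv.addLeft y).bijective.sum_comp]
  refine Finset.sum_congr rfl fun d _ => ?_
  simp only [Equiv.coe_addLeft, add_sub_cancel_left]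
  ring

lemma my_logdet {n : ℕ} (hpn : p = 2 * n + 1) (A B : ZMod p)
    (hAB : quadraticChar (ZMod p) (-(A * B)) = -1) (X Y : Fin n → ZMod p)
    (hX : ∀ j : Fin n, X j = A * (((j : ℕ) + 1 : ℕ) : ZMod p) ^ 2)
    (hY : ∀ j : Fin n, Y j = -B * (((j : ℕ) + 1 : ℕ) : ZMod p) ^ 2) :
    ∑ i, ∑ j, myL p (X i - X j) + ∑ i, ∑ j, myL p (Y i - Y j) - 2 * ∑ i, ∑ j, myL p (X i - Y j)
     = - Real.log p := by
  have hns := quadraticChar_neg_one_iff_not_isSquare.1 hAB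
  have hA : A ≠ 0 := by rintro rfl; simp at hns
  rw [← my_charsum (p := p) (by omega), my_split1 hpn A B hAB]
  simp only [my_split1 hpn A B hAB, ← hX, ← hY]
  have h1 : (quadraticChar (ZMod p) A : ℝ) ^ 2 = 1 := by
    exact_mod_cast quadraticChar_sq_one hA
  rw [← Finset.mul_sum, ← Finset.mul_sum, ← mul_sub, ← mul_assoc, ← sq, h1, one_mul]
  simp only [Finset.sum_sub_distrib]
  have : ∑ k, ∑ j, myL p (Y k - X j) = ∑ i, ∑ j, myL p (X i - Y j) := by
    rw [Finset.sum_comm]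
    exact Finset.sum_congr rfl fun i _ => Finset.sum_congr rfl fun j _ => myL_symm _ _
  rw [this]; ring

end Norms

section RedSec
open Polynomial
variable {p : ℕ} [Fact p.Prime]

/-- reduction modulo the prime above `p` -/
def MyRed (p : ℕ) [Fact p.Prime] (z : ℂ) (c : ZMod p) : Prop :=
  ∃ F : ℤ[X], aeval (ZMod.stdAddChar (1 : ZMod p) : ℂ) F = z ∧ ((F.eval 1 : ℤ) : ZMod p) = c

lemma MyRed.unique {z : ℂ} {c d : ZMod p} (h1 : MyRed p z c) (h2 : MyRed p z d) : c = d := by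
  obtain ⟨F, hF, rfl⟩ := h1
  obtain ⟨G, hG, rfl⟩ := h2
  have hz : aeval (ZMod.stdAddChar (1 : ZMod p) : ℂ) (F - G) = 0 := by
    rw [map_sub, hF, hG, sub_self]
  have hprim := my_psi_prim (p := p)
  have hpos := (Fact.out : p.Prime).pos
  have hd := minpoly.isIntegrallyClosed_dvd (hprim.isIntegral hpos) hz
  rw [← cyclotomic_eq_minpoly hprim hpos] at hd
  obtain ⟨K, hK⟩ := hd
  have := congrArg (eval 1) hK
  rw [eval_mul, eval_one_cyclotomic_prime, eval_sub] at this
  have h3 := congrArg (Int.cast : ℤ → ZMod p) this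
  push_cast at h3
  simpa [sub_eq_zero] using h3

lemma MyRed.mul {z w : ℂ} {c d : ZMod p} (h1 : MyRed p z c) (h2 : MyRed p w d) :
    MyRed p (z * w) (c * d) := by
  obtain ⟨F, rfl, rfl⟩ := h1
  obtain ⟨G, rfl, rfl⟩ := h2
  exact ⟨F * G, by simp, by simp⟩

lemma MyRed.int (m : ℤ) : MyRed p (m : ℂ) (m : ZMod p) := ⟨C m, by simp, by simp⟩

lemma MyRed.prod {ι : Type*} (s : Finset ι) {z : ι → ℂ} {c : ι → ZMod p}
    (h : ∀ i ∈ s, MyRed p (z i) (c i)) : MyRed p (∏ i ∈ s, z i) (∏ i ∈ s, c i) := by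
  classical
  induction s using Finset.induction_on with
  | empty => simpa using MyRed.int (p := p) 1
  | insert i s hi ih =>
    rw [Finset.prod_insert hi, Finset.prod_insert hi]
    exact (h i (by simp)).mul (ih fun j hj => h j (by simp [hj]))

lemma my_q_ne : (ZMod.stdAddChar (1 : ZMod p) : ℂ) - 1 ≠ 0 := by
  rw [sub_ne_zero]
  exact (my_psi_prim (p := p)).ne_one (Fact.out : p.Prime).one_lt

lemma MyRed.psi (x : ZMod p) : MyRed p (ZMod.stdAddChar x : ℂ) 1 := by
  refine ⟨X ^ x.val, ?_, by simp⟩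
  rw [map_pow, aeval_X, ← my_psi_nat, ZMod.natCast_zmod_val]

lemma MyRed.quot (x y : ZMod p) :
    MyRed p ((ZMod.stdAddChar x : ℂ) / (ZMod.stdAddChar (1 : ZMod p) - 1) -
      ZMod.stdAddChar y / (ZMod.stdAddChar (1 : ZMod p) - 1)) (x - y) := by
  have h1 : MyRed p (∑ i ∈ Finset.range (x - y).val, (ZMod.stdAddChar (1 : ZMod p) : ℂ) ^ i)
      (x - y) :=
    ⟨∑ i ∈ Finset.range (x - y).val, X ^ i, by simp, by simp [eval_finsetSum]⟩
  have h2 := (MyRed.psi y).mul h1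
  rw [one_mul] at h2
  convert h2 using 1
  have hq := my_q_ne (p := p)
  rw [← sub_div, div_eq_iff hq, mul_assoc, geom_sum_mul, ← my_psi_nat, ZMod.natCast_zmod_val,
    mul_sub, ← AddChar.map_add_eq_mul]
  simp

end RedSec

section Fin
open Polynomial
variable {p : ℕ} [Fact p.Prime]

lemma my_sqpoly {n : ℕ} (hpn : p = 2 * n + 1) :
    Lagrange.nodal Finset.univ (fun j : Fin n => (((j : ℕ) + 1 : ℕ) : ZMod p) ^ 2) = X ^ n - 1 := by
  have hn : n ≠ 0 := by
    rintro rfl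
    have := (Fact.out : p.Prime).two_le
    omega
  have hinj : Function.Injective (fun j : Fin n => (((j : ℕ) + 1 : ℕ) : ZMod p) ^ 2) :=
    fun i j h => my_cast_inj hpn i j h
  have hm1 := Lagrange.nodal_monic (s := Finset.univ)
    (v := fun j : Fin n => (((j : ℕ) + 1 : ℕ) : ZMod p) ^ 2)
  have hm2 : (X ^ n - 1 : (ZMod p)[X]).Monic := monic_X_pow_sub_C 1 hn
  have hd2 : (X ^ n - 1 : (ZMod p)[X]).degree = n := degree_X_pow_sub_C (Nat.pos_of_ne_zero hn) 1
  have hd1 := Lagrange.degree_nodal (s := Finset.univ)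
    (v := fun j : Fin n => (((j : ℕ) + 1 : ℕ) : ZMod p) ^ 2)
  rw [Finset.card_univ, Fintype.card_fin] at hd1
  refine Polynomial.eq_of_degree_sub_lt_of_eval_index_eq (Finset.univ)
    (v := fun j : Fin n => (((j : ℕ) + 1 : ℕ) : ZMod p) ^ 2) hinj.injOn ?_ ?_
  · refine (degree_sub_lt_left (hd1.trans hd2.symm) hm1.ne_zero ?_).trans_eq ?_
    · rw [hm1.leadingCoeff, hm2.leadingCoeff]
    · rw [hd1]; simp
  · intro i _
    have h0 := Lagrange.eval_nodal_at_node
      (v := fun j : Fin n => (((j : ℕ) + 1 : ℕ) : ZMod p) ^ 2) (Finset.mem_univ i)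
    refine h0.trans ?_
    have : (((i : ℕ) + 1 : ℕ) : ZMod p) ^ (p - 1) = 1 :=
      ZMod.pow_card_sub_one_eq_one (my_cast_ne hpn i)
    have e : p - 1 = 2 * n := by omega
    rw [e] at this
    simp only [eval_sub, eval_pow, eval_X, eval_one]
    rw [← pow_mul, this, sub_self]

lemma my_two_pow {h : ℕ} (hph : p = 4 * h + 1) : (2 : ZMod p) ^ (2 * h) = (-1) ^ h := by
  have hc : ringChar (ZMod p) ≠ 2 := by rw [ZMod.ringChar_zmod_n]; omega
  have h1 := quadraticChar_eq_pow_of_char_ne_two' hc (2 : ZMod p)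
  rw [quadraticChar_two hc, ZMod.card, ZMod.χ₈_nat_eq_if_mod_eight] at h1
  have e : p / 2 = 2 * h := by omega
  rw [e] at h1
  rw [← h1, if_neg (by omega)]
  rcases Nat.even_or_odd' h with ⟨c, hc | hc⟩
  · rw [if_pos (by omega), hc, pow_mul]; simp
  · rw [if_neg (by omega), hc, pow_succ, pow_mul]; simp

lemma my_card_pairs (g : ℕ) :
    ∑ i : Fin (2 * (g + 1)), (Finset.Ioi i).card = (g + 1) * (2 * g + 1) := by
  simp only [Fin.card_Ioi]
  rw [← Finset.sum_range (fun i => 2 * (g + 1) - 1 - i), Finset.sum_range_reflect (fun i => i)]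
  have := Finset.sum_range_id_mul_two (2 * (g + 1))
  have e : 2 * (g + 1) - 1 = 2 * g + 1 := by omega
  rw [e] at this
  nlinarith

lemma my_zmod {g n : ℕ} (hn : n = 2 * (g + 1)) (hpn : p = 2 * n + 1) (A B : ZMod p)
    (hAB : quadraticChar (ZMod p) (-(A * B)) = -1) (X Y : Fin n → ZMod p)
    (hX : ∀ j : Fin n, X j = A * (((j : ℕ) + 1 : ℕ) : ZMod p) ^ 2)
    (hY : ∀ j : Fin n, Y j = -B * (((j : ℕ) + 1 : ℕ) : ZMod p) ^ 2) (s : ZMod p)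
    (hs : s * ∏ j, ∏ k, (X j - Y k) = (∏ i, ∏ j ∈ Finset.Ioi i, ((X j - X i) * (Y i - Y j))) *
      ∏ k : Fin n, ((((k : ℕ) + 1 : ℕ) : ZMod p) - -(((k : ℕ) + 1 : ℕ) : ZMod p))) :
    s = (-1) ^ (g + 1) * (A * B) ^ (g + 1) * (n.factorial : ZMod p) ∧
      ((A * B) ^ (g + 1)) ^ 2 = -1 ∧ (n.factorial : ZMod p) ^ 2 = -1 := by
  have hns := quadraticChar_neg_one_iff_not_isSquare.1 hAB
  have hA : A ≠ 0 := by rintro rfl; simp at hns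
  have hB : B ≠ 0 := by rintro rfl; simp at hns
  have hc : ringChar (ZMod p) ≠ 2 := by rw [ZMod.ringChar_zmod_n]; omega
  have hABn : (A * B) ^ n = -1 := by
    have h1 := quadraticChar_eq_pow_of_char_ne_two' hc (-(A * B))
    have e : p / 2 = n := by omega
    rw [hAB, ZMod.card, e, Even.neg_pow ⟨g + 1, by omega⟩] at h1
    rw [← h1]; simp
  have hw : ((A * B) ^ (g + 1)) ^ 2 = -1 := by
    rw [← pow_mul, ← hABn, hn]; congr 1; ring
  set sq : Fin n → ZMod p := fun j => (((j : ℕ) + 1 : ℕ) : ZMod p) ^ 2 with hsq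
  have hpoly := my_sqpoly (p := p) hpn
  have heval : ∀ t : ZMod p, ∏ j, (t - sq j) = t ^ n - 1 := by
    intro t
    have := congrArg (eval t) hpoly
    rw [Lagrange.eval_nodal] at this
    simpa only [eval_sub, eval_pow, eval_X, eval_one] using this
  have hneven : Even n := ⟨g + 1, by omega⟩
  have hprodsq : ∏ j, sq j = -1 := by
    have := heval 0
    simp only [zero_sub] at this
    rw [Finset.prod_neg, Finset.card_univ, Fintype.card_fin, hneven.neg_one_pow, one_mul,
      zero_pow (by omega)] at this
    rw [this]; ring
  have hfac : ∏ k : Fin n, (((k : ℕ) + 1 : ℕ) : ZMod p) = (n.factorial : ZMod p) := by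
    rw [← Nat.cast_prod, ← Finset.prod_range (fun k => k + 1), Finset.prod_range_add_one_eq_factorial]
  have hfac2 : (n.factorial : ZMod p) ^ 2 = -1 := by
    rw [← hfac, ← Finset.prod_pow]; exact hprodsq
  refine ⟨?_, hw, hfac2⟩
  have hder : ∀ i, ∏ j ∈ ({i} : Finset (Fin n))ᶜ, (sq i - sq j) = n * sq i ^ (n - 1) := by
    intro i
    have := Lagrange.eval_nodal_derivative_eval_node_eq (v := sq) (Finset.mem_univ i)
    rw [hpoly, Lagrange.eval_nodal] at this
    have e : ({i} : Finset (Fin n))ᶜ = Finset.univ.erase i := by ext; simp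
    rw [e, ← this]
    simp [derivative_X_pow]
  have hnum : ∏ i, ∏ j ∈ Finset.Ioi i, ((X j - X i) * (Y i - Y j)) =
      (-(A * B)) ^ ((g + 1) * (2 * g + 1)) * ((n : ZMod p) ^ n * (-1)) := by
    have e1 : ∀ i j, (X j - X i) * (Y i - Y j) =
        (-(A * B)) * ((sq i - sq j) * (sq j - sq i)) := by
      intro i j
      rw [hX, hX, hY, hY]; simp only [hsq]; ring
    simp only [e1, Finset.prod_mul_distrib (f := fun _ => -(A * B)), Finset.prod_const]
    rw [Finset.prod_mul_distrib, Finset.prod_prod_Ioi_mul_eq_prod_prod_off_diag (fun j i => sq i - sq j),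
      Finset.prod_pow_eq_pow_sum]
    simp only [hder]
    rw [Finset.prod_mul_distrib, Finset.prod_const, Finset.card_univ, Fintype.card_fin,
      Finset.prod_pow, hprodsq, Odd.neg_one_pow ⟨g, by omega⟩]
    subst hn
    rw [my_card_pairs]
  have hAn : (A ^ n) ^ n = 1 := by
    have : A ^ (p - 1) = 1 := ZMod.pow_card_sub_one_eq_one hA
    have e : p - 1 = 2 * n := by omega
    rw [e] at this
    have e2 : n * n = (2 * n) * (g + 1) := by rw [hn]; ring
    rw [← pow_mul, e2, pow_mul, this, one_pow]
  have hAn2 : (A ^ n) ^ 2 = 1 := by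
    have : A ^ (p - 1) = 1 := ZMod.pow_card_sub_one_eq_one hA
    have e : p - 1 = n * 2 := by omega
    rwa [e, pow_mul] at this
  have hden : ∏ j, ∏ k, (X j - Y k) = 2 ^ n := by
    rw [Finset.prod_comm]
    have e1 : ∀ k, ∏ j, (X j - Y k) = A ^ n * (-2) := by
      intro k
      have e2 : ∀ j, X j - Y k = (-A) * ((-B / A) * sq k - sq j) := by
        intro j
        rw [hX, hY]; simp only [hsq]; field_simp; ring
      simp only [e2]
      rw [Finset.prod_mul_distrib, Finset.prod_const, Finset.card_univ, Fintype.card_fin, heval,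
        hneven.neg_pow]
      congr 1
      have h1 : sq k ^ n = 1 := by
        have := heval (sq k)
        rw [Finset.prod_eq_zero (Finset.mem_univ k) (sub_self _)] at this
        linear_combination -this
      rw [mul_pow, h1, div_pow, hneven.neg_pow, mul_one]
      have hAn0 : A ^ n ≠ 0 := pow_ne_zero _ hA
      rw [mul_pow] at hABn
      have : B ^ n / A ^ n = -1 := by
        rw [div_eq_iff hAn0]
        linear_combination (-B ^ n) * hAn2 + A ^ n * hABn
      rw [this]; norm_num
    simp only [e1]
    rw [Finset.prod_const, Finset.card_univ, Fintype.card_fin, mul_pow, hAn, one_mul,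
      hneven.neg_pow]
  have hlast : ∏ k : Fin n, ((((k : ℕ) + 1 : ℕ) : ZMod p) - -(((k : ℕ) + 1 : ℕ) : ZMod p)) =
      2 ^ n * (n.factorial : ZMod p) := by
    rw [← hfac]
    have : ∀ k : Fin n, ((((k : ℕ) + 1 : ℕ) : ZMod p) - -(((k : ℕ) + 1 : ℕ) : ZMod p)) =
      2 * (((k : ℕ) + 1 : ℕ) : ZMod p) := fun k => by ring
    simp only [this]
    rw [Finset.prod_mul_distrib, Finset.prod_const, Finset.card_univ, Fintype.card_fin]
  have h2n : (n : ZMod p) ^ n * 2 ^ n = 1 := by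
    have h0 : ((2 * n + 1 : ℕ) : ZMod p) = 0 := by rw [← hpn]; simp
    have h1 : (n : ZMod p) * 2 = -1 := by push_cast at h0; linear_combination h0
    rw [← mul_pow, h1, hneven.neg_one_pow]
  rw [hnum, hden, hlast] at hs
  have htwo : (2 : ZMod p) ^ n = (-1) ^ (g + 1) := by
    rw [hn]; exact my_two_pow (by omega)
  have hN : (-(A * B)) ^ ((g + 1) * (2 * g + 1)) = -(A * B) ^ (g + 1) := by
    rw [pow_mul, neg_pow, pow_succ, pow_mul, mul_pow, hw, ← pow_mul, mul_comm (g + 1) 2, pow_mul,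
      neg_one_sq, one_pow, one_mul, pow_succ (-1 : ZMod p)]
    have : (-1 : ZMod p) ^ g * (-1) ^ g = 1 := by rw [← mul_pow]; simp
    linear_combination (-(A * B) ^ (g + 1)) * this
  have hsg : ((-1 : ZMod p) ^ (g + 1)) * (-1) ^ (g + 1) = 1 := by rw [← mul_pow]; simp
  rw [hN, htwo] at hs
  rw [htwo] at h2n
  linear_combination ((-1 : ZMod p) ^ (g + 1)) * hs - s * hsg +
    ((-1 : ZMod p) ^ (g + 1)) * (A * B) ^ (g + 1) * (n.factorial : ZMod p) * h2n

end Fin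

section Final
variable {p : ℕ} [Fact p.Prime]

lemma my_XY_ne {n : ℕ} (hpn : p = 2 * n + 1) (A B : ZMod p)
    (hAB : quadraticChar (ZMod p) (-(A * B)) = -1) (j k : Fin n) :
    A * (((j : ℕ) + 1 : ℕ) : ZMod p) ^ 2 ≠ -B * (((k : ℕ) + 1 : ℕ) : ZMod p) ^ 2 := by
  have hns := quadraticChar_neg_one_iff_not_isSquare.1 hAB
  have hA : A ≠ 0 := by rintro rfl; simp at hns
  intro h
  apply hns
  have hk := my_cast_ne hpn k
  refine ⟨A * (((j : ℕ) + 1 : ℕ) : ZMod p) / (((k : ℕ) + 1 : ℕ) : ZMod p), ?_⟩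
  field_simp
  linear_combination -h

lemma my_sumsq {n : ℕ} (hpn : p = 2 * n + 1) (hp : 3 < p) :
    ∑ j : Fin n, (((j : ℕ) + 1 : ℕ) : ZMod p) ^ 2 = 0 := by
  have h1 : ∀ m : ℕ, 6 * ∑ j ∈ Finset.range m, (j + 1) ^ 2 = m * (m + 1) * (2 * m + 1) := by
    intro m
    induction m with
    | zero => simp
    | succ m ih => rw [Finset.sum_range_succ, mul_add, ih]; ring
  have h2 := congrArg (Nat.cast : ℕ → ZMod p) (h1 n)
  rw [← hpn, Nat.cast_mul, Nat.cast_mul _ p, ZMod.natCast_self p, mul_zero] at h2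
  have h6 : ((6 : ℕ) : ZMod p) ≠ 0 := by
    intro h
    rw [ZMod.natCast_eq_zero_iff] at h
    have hpp := (Fact.out : p.Prime)
    have : p ∣ 2 * 3 := h
    rcases hpp.dvd_mul.1 this with h | h
    · have := Nat.le_of_dvd (by norm_num) h; omega
    · have := Nat.le_of_dvd (by norm_num) h; omega
  have h3 := (mul_eq_zero.1 h2).resolve_left h6
  rw [Finset.sum_range] at h3
  push_cast at h3 ⊢
  exact h3

lemma my_prod_psi {n : ℕ} (hpn : p = 2 * n + 1) (hp : 3 < p) (A : ZMod p) :
    ∏ j : Fin n, (ZMod.stdAddChar (A * (((j : ℕ) + 1 : ℕ) : ZMod p) ^ 2) : ℂ) = 1 := by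
  have h : ∀ s : Finset (Fin n), ∏ j ∈ s,
      (ZMod.stdAddChar (A * (((j : ℕ) + 1 : ℕ) : ZMod p) ^ 2) : ℂ) =
      ZMod.stdAddChar (∑ j ∈ s, A * (((j : ℕ) + 1 : ℕ) : ZMod p) ^ 2) := by
    intro s
    classical
    induction s using Finset.induction_on with
    | empty => simp
    | insert i s hi ih =>
      rw [Finset.prod_insert hi, Finset.sum_insert hi, AddChar.map_add_eq_mul, ih]
  rw [h, ← Finset.mul_sum, my_sumsq hpn hp, mul_zero, AddChar.map_zero_eq_one]

lemma my_cot (m : ℤ) (x y : ZMod p) (hm : (m : ZMod p) = x - y) (hxy : x ≠ y) :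
    ((Real.cot (Real.pi * (m : ℝ) / p) : ℝ) : ℂ) = Complex.I + 2 * Complex.I *
      (ZMod.stdAddChar y * ((ZMod.stdAddChar x : ℂ) - ZMod.stdAddChar y)⁻¹) := by
  have hne : (ZMod.stdAddChar x : ℂ) - ZMod.stdAddChar y ≠ 0 :=
    sub_ne_zero.2 fun h => hxy (ZMod.injective_stdAddChar h)
  have hy0 : (ZMod.stdAddChar y : ℂ) ≠ 0 := by
    rw [← norm_ne_zero_iff, my_norm_psi]; exact one_ne_zero
  have hz := ZMod.stdAddChar_coe (N := p) m
  have hx : (ZMod.stdAddChar x : ℂ) = ZMod.stdAddChar (m : ZMod p) * ZMod.stdAddChar y := by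
    rw [hm, ← AddChar.map_add_eq_mul, sub_add_cancel]
  have e1 : Complex.exp (2 * Complex.I * (Real.pi * (m : ℝ) / p : ℝ)) =
      ZMod.stdAddChar (m : ZMod p) := by
    rw [hz]; congr 1; push_cast; ring
  rw [Complex.ofReal_cot, Complex.cot_eq_exp_ratio, e1]
  rw [hx] at hne ⊢
  generalize (ZMod.stdAddChar (m : ZMod p) : ℂ) = z at *
  generalize (ZMod.stdAddChar y : ℂ) = w at *
  have hz1 : z - 1 ≠ 0 := by
    intro h
    apply hne
    linear_combination w * h
  have hz2 : 1 - z ≠ 0 := by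
    intro h; apply hz1; linear_combination -h
  have hI := Complex.I_ne_zero
  have e3 : z * w - w = (z - 1) * w := by ring
  have e4 : 1 - z = - (z - 1) := by ring
  rw [e3, e4, div_eq_iff (mul_ne_zero hI (neg_ne_zero.2 hz1)), mul_inv]
  field_simp
  linear_combination (z+1) * Complex.I_sq

lemma my_det_eq {n : ℕ} (u v : Fin n → ℂ) (hu : ∏ j, u j = 1) (hv : ∏ j, v j = 1)
    (hui : Function.Injective u)
    (hvi : Function.Injective v) (huv : ∀ j k, u j ≠ v k) (s : ℂ) :
    (Matrix.of fun j k => s + 2 * Complex.I * (v k * (u j - v k)⁻¹)).det =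
      (2 * Complex.I) ^ n * (Matrix.of fun j k => (u j - v k)⁻¹).det ∧
      (Matrix.of fun j k => (u j - v k)⁻¹).det ≠ 0 := by
  have hI : (2 * Complex.I) ≠ 0 := by simp
  have hD : (Matrix.of fun j k => (u j - v k)⁻¹).det ≠ 0 := by
    have h := my_cauchy u v hvi huv
    intro h0
    rw [h0, zero_mul, eq_comm, Finset.prod_eq_zero_iff] at h
    obtain ⟨i, -, hi⟩ := h
    rw [Finset.prod_eq_zero_iff] at hi
    obtain ⟨j, hj, hij⟩ := hi
    rw [Finset.mem_Ioi] at hj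
    rcases mul_eq_zero.1 hij with h | h
    · exact hj.ne' (hui (sub_eq_zero.1 h))
    · exact hj.ne (hvi (sub_eq_zero.1 h))
  have hdet1 : (Matrix.of fun j k => 2 * Complex.I * (v k * (u j - v k)⁻¹)).det =
      (2 * Complex.I) ^ n * (Matrix.of fun j k => (u j - v k)⁻¹).det := by
    have e : (Matrix.of fun j k => 2 * Complex.I * (v k * (u j - v k)⁻¹)) =
        (2 * Complex.I) • Matrix.of fun j k => v k * (Matrix.of fun j k => (u j - v k)⁻¹) j k := by
      ext j k; simp
    rw [e, Matrix.det_smul, Matrix.det_mul_row, hv, one_mul, Fintype.card_fin]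
  have hdet2 : (Matrix.of fun j k => 2 * Complex.I + 2 * Complex.I * (v k * (u j - v k)⁻¹)).det =
      (2 * Complex.I) ^ n * (Matrix.of fun j k => (u j - v k)⁻¹).det := by
    have e : (Matrix.of fun j k => 2 * Complex.I + 2 * Complex.I * (v k * (u j - v k)⁻¹)) =
        (2 * Complex.I) • Matrix.of fun j k => u j * (Matrix.of fun j k => (u j - v k)⁻¹) j k := by
      ext j k
      have := sub_ne_zero.2 (huv j k)
      simp only [Matrix.of_apply, Matrix.smul_apply, smul_eq_mul]
      field_simp
      ring
    rw [e, Matrix.det_smul, Matrix.det_mul_column, hu, one_mul, Fintype.card_fin]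
  refine ⟨?_, hD⟩
  have := my_affine (Matrix.of fun j k => 2 * Complex.I * (v k * (u j - v k)⁻¹))
    (by rw [hdet1]; exact mul_ne_zero (pow_ne_zero _ hI) hD) (2 * Complex.I) hI
    (by rw [hdet1, ← hdet2]; rfl) s
  rw [hdet1] at this
  rw [← this]; rfl

lemma my_ioi_sum {n : ℕ} (X : Fin n → ZMod p) :
    2 * ∑ i, ∑ j ∈ Finset.Ioi i, myL p (X j - X i) = ∑ i, ∑ j, myL p (X i - X j) := by
  have h1 := Finset.sum_sum_Ioi_add_eq_sum_sum_off_diag (fun i j => myL p (X j - X i))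
  have h2 : ∀ i, ∑ j, myL p (X i - X j) = ∑ j ∈ ({i} : Finset (Fin n))ᶜ, myL p (X i - X j) := by
    intro i
    rw [← Finset.sum_compl_add_sum ({i} : Finset (Fin n)), Finset.sum_singleton, sub_self, myL_zero,
      add_zero]
  simp only [h2]
  rw [← h1, Finset.mul_sum]
  refine Finset.sum_congr rfl fun i _ => ?_
  rw [Finset.mul_sum]
  refine Finset.sum_congr rfl fun j _ => ?_
  rw [myL_symm (X i) (X j)]; ring

lemma my_normD {n : ℕ} (hpn : p = 2 * n + 1) (A B : ZMod p)
    (hAB : quadraticChar (ZMod p) (-(A * B)) = -1) (X Y : Fin n → ZMod p)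
    (hX : ∀ j : Fin n, X j = A * (((j : ℕ) + 1 : ℕ) : ZMod p) ^ 2)
    (hY : ∀ j : Fin n, Y j = -B * (((j : ℕ) + 1 : ℕ) : ZMod p) ^ 2)
    (hXi : Function.Injective X) (hYi : Function.Injective Y) (hXY : ∀ j k, X j ≠ Y k)
    (D : ℂ) (hD0 : D ≠ 0)
    (hD : D * ∏ j, ∏ k, ((ZMod.stdAddChar (X j) : ℂ) - ZMod.stdAddChar (Y k)) =
      ∏ i, ∏ j ∈ Finset.Ioi i, (((ZMod.stdAddChar (X j) : ℂ) - ZMod.stdAddChar (X i)) *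
        (ZMod.stdAddChar (Y i) - ZMod.stdAddChar (Y j)))) :
    ‖D‖ * Real.sqrt p = 1 := by
  have hp0 : (0 : ℝ) < p := by exact_mod_cast (Fact.out : p.Prime).pos
  have hne : ∀ x y : ZMod p, x ≠ y → ‖(ZMod.stdAddChar x : ℂ) - ZMod.stdAddChar y‖ ≠ 0 :=
    fun x y h => norm_ne_zero_iff.2 (sub_ne_zero.2 fun h' => h (ZMod.injective_stdAddChar h'))
  have h1 := congrArg (fun z : ℂ => Real.log ‖z‖) hD
  simp only [norm_mul, norm_prod] at h1
  rw [Real.log_mul (norm_ne_zero_iff.2 hD0)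
    (Finset.prod_ne_zero_iff.2 fun j _ => Finset.prod_ne_zero_iff.2 fun k _ => hne _ _ (hXY j k)),
    Real.log_prod (fun j _ => Finset.prod_ne_zero_iff.2 fun k _ => hne _ _ (hXY j k)),
    Real.log_prod (fun i _ => Finset.prod_ne_zero_iff.2 fun j hj => mul_ne_zero
      (hne _ _ fun h => (Finset.mem_Ioi.1 hj).ne' (hXi h))
      (hne _ _ fun h => (Finset.mem_Ioi.1 hj).ne (hYi h)))] at h1
  have h2 : ∀ j, Real.log (∏ k, ‖(ZMod.stdAddChar (X j) : ℂ) - ZMod.stdAddChar (Y k)‖) =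
      ∑ k, myL p (X j - Y k) := by
    intro j
    rw [Real.log_prod (fun k _ => hne _ _ (hXY j k))]
    exact Finset.sum_congr rfl fun k _ => myL_sub _ _
  have h3 : ∀ i, Real.log (∏ j ∈ Finset.Ioi i,
      (‖(ZMod.stdAddChar (X j) : ℂ) - ZMod.stdAddChar (X i)‖ *
        ‖(ZMod.stdAddChar (Y i) : ℂ) - ZMod.stdAddChar (Y j)‖)) =
      ∑ j ∈ Finset.Ioi i, myL p (X j - X i) + ∑ j ∈ Finset.Ioi i, myL p (Y j - Y i) := by
    intro i
    rw [Real.log_prod (fun j hj => mul_ne_zero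
      (hne _ _ fun h => (Finset.mem_Ioi.1 hj).ne' (hXi h))
      (hne _ _ fun h => (Finset.mem_Ioi.1 hj).ne (hYi h))), ← Finset.sum_add_distrib]
    refine Finset.sum_congr rfl fun j hj => ?_
    rw [Real.log_mul (hne _ _ fun h => (Finset.mem_Ioi.1 hj).ne' (hXi h))
      (hne _ _ fun h => (Finset.mem_Ioi.1 hj).ne (hYi h)), myL_sub, myL_sub, myL_symm (Y i)]
  simp only [h2, h3] at h1
  rw [Finset.sum_add_distrib] at h1
  have h4 := my_logdet hpn A B hAB X Y hX hY
  rw [← my_ioi_sum, ← my_ioi_sum] at h4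
  have hpos : 0 < ‖D‖ * Real.sqrt p := mul_pos (norm_pos_iff.2 hD0) (Real.sqrt_pos.2 hp0)
  have h5 : Real.log (‖D‖ * Real.sqrt p) = 0 := by
    rw [Real.log_mul (norm_ne_zero_iff.2 hD0) (Real.sqrt_pos.2 hp0).ne', Real.log_sqrt hp0.le]
    linarith
  exact Real.eq_one_of_pos_of_log_eq_zero hpos h5

end Final

theorem stmt16 (p : ℕ) [Fact p.Prime] (hp : 3 < p) (hp4 : p % 4 = 1) (a b : ℤ)
    (hab : legendreSym p (-(a * b)) = -1) (x : ℝ) :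
    Matrix.det (Matrix.of fun j k : Fin ((p - 1) / 2) =>
      x + Real.cot (Real.pi *
        ((a * (((j : ℕ) : ℤ) + 1) ^ 2 + b * (((k : ℕ) : ℤ) + 1) ^ 2 : ℤ) : ℝ) / p)) =
    (-1 : ℝ) ^ ((p + 3) / 4) * (deltaP p (a * b) : ℝ) *
      2 ^ ((p - 1) / 2) / Real.sqrt p := by
  obtain ⟨g, hg⟩ : ∃ g, p = 4 * (g + 1) + 1 := ⟨(p - 5) / 4, by omega⟩
  have hp0 : (0 : ℝ) < p := by exact_mod_cast (Fact.out : p.Prime).pos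
  have hsq0 : 0 < Real.sqrt p := Real.sqrt_pos.2 hp0
  have e34 : (p + 3) / 4 = g + 2 := by omega
  have e14 : (p - 1) / 4 = g + 1 := by omega
  rw [deltaP, e34, e14]
  have hn : (p - 1) / 2 = 2 * (g + 1) := by omega
  have hpn : p = 2 * ((p - 1) / 2) + 1 := by omega
  generalize (p - 1) / 2 = n at hn hpn ⊢
  set A : ZMod p := (a : ZMod p) with hAdef
  set B : ZMod p := (b : ZMod p) with hBdef
  have hAB : quadraticChar (ZMod p) (-(A * B)) = -1 := by
    rw [legendreSym] at hab
    push_cast at hab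
    exact hab
  have hns := quadraticChar_neg_one_iff_not_isSquare.1 hAB
  have hA : A ≠ 0 := by intro h; rw [h] at hns; simp at hns
  have hB : B ≠ 0 := by intro h; rw [h] at hns; simp at hns
  obtain ⟨X, hX⟩ : ∃ X : Fin n → ZMod p, ∀ j : Fin n, X j = A * (((j : ℕ) + 1 : ℕ) : ZMod p) ^ 2 :=
    ⟨_, fun _ => rfl⟩
  obtain ⟨Y, hY⟩ : ∃ Y : Fin n → ZMod p, ∀ j : Fin n, Y j = -B * (((j : ℕ) + 1 : ℕ) : ZMod p) ^ 2 :=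
    ⟨_, fun _ => rfl⟩
  have hXi : Function.Injective X := by
    intro i j h
    rw [hX, hX] at h
    exact my_cast_inj hpn i j (mul_left_cancel₀ hA h)
  have hYi : Function.Injective Y := by
    intro i j h
    rw [hY, hY] at h
    exact my_cast_inj hpn i j (mul_left_cancel₀ (neg_ne_zero.2 hB) h)
  have hXY : ∀ j k, X j ≠ Y k := by
    intro j k; rw [hX, hY]; exact my_XY_ne hpn A B hAB j k
  obtain ⟨u, hu⟩ : ∃ u : Fin n → ℂ, ∀ j, u j = ZMod.stdAddChar (X j) := ⟨_, fun _ => rfl⟩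
  obtain ⟨v, hv⟩ : ∃ v : Fin n → ℂ, ∀ j, v j = ZMod.stdAddChar (Y j) := ⟨_, fun _ => rfl⟩
  have hui : Function.Injective u := by
    intro i j h; rw [hu, hu] at h; exact hXi (ZMod.injective_stdAddChar h)
  have hvi : Function.Injective v := by
    intro i j h; rw [hv, hv] at h; exact hYi (ZMod.injective_stdAddChar h)
  have huv : ∀ j k, u j ≠ v k := by
    intro j k h; rw [hu, hv] at h; exact hXY j k (ZMod.injective_stdAddChar h)
  have hpu : ∏ j, u j = 1 := by simp only [hu, hX]; exact my_prod_psi hpn hp A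
  have hpv : ∏ j, v j = 1 := by simp only [hv, hY]; exact my_prod_psi hpn hp (-B)
  obtain ⟨hdet, hD0⟩ := my_det_eq u v hpu hpv hui hvi huv ((x : ℂ) + Complex.I)
  set D : ℂ := (Matrix.of fun j k => (u j - v k)⁻¹).det with hDdef
  set Dt : ℝ := Matrix.det (Matrix.of fun j k : Fin n =>
      x + Real.cot (Real.pi *
        ((a * (((j : ℕ) : ℤ) + 1) ^ 2 + b * (((k : ℕ) : ℤ) + 1) ^ 2 : ℤ) : ℝ) / p)) with hDt
  have hDtD : (Dt : ℂ) = (2 * Complex.I) ^ n * D := by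
    rw [← hdet, hDt]
    change Complex.ofRealHom _ = _
    rw [RingHom.map_det]
    congr 1
    ext j k
    have hc := my_cot (p := p) (a * (((j : ℕ) : ℤ) + 1) ^ 2 + b * (((k : ℕ) : ℤ) + 1) ^ 2) (X j) (Y k)
      (by rw [hX, hY]; push_cast; ring) (hXY j k)
    rw [RingHom.mapMatrix_apply, Matrix.map_apply, Matrix.of_apply, Matrix.of_apply, map_add,
      Complex.ofRealHom_eq_coe, Complex.ofRealHom_eq_coe, hc, hu, hv, add_assoc]
  have hnorm : ‖D‖ * Real.sqrt p = 1 := by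
    refine my_normD hpn A B hAB X Y hX hY hXi hYi hXY D hD0 ?_
    have := my_cauchy u v hvi huv
    simp only [hu, hv] at this
    rw [hDdef]
    simp only [hu, hv]
    exact this
  have hP := my_P (p := p) hpn
  have hq := my_q_ne (p := p)
  set q : ℂ := (ZMod.stdAddChar (1 : ZMod p) : ℂ) - 1 with hqdef
  -- the sign
  obtain ⟨s, hs⟩ : ∃ s : ℝ, s = Dt * Real.sqrt p / 2 ^ n := ⟨_, rfl⟩
  have hsD : (s : ℂ) = D * (Complex.I ^ n * (Real.sqrt p : ℂ)) := by
    rw [hs]; push_cast; rw [hDtD, mul_pow]; field_simp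
  have habs : |s| = 1 := by
    have := congrArg norm hsD
    rw [norm_mul, norm_mul, norm_pow, Complex.norm_I, one_pow, one_mul, Complex.norm_real,
      Complex.norm_real, Real.norm_of_nonneg hsq0.le, hnorm] at this
    exact this
  obtain ⟨e, he, hse⟩ : ∃ e : ℤ, (e = 1 ∨ e = -1) ∧ s = e := by
    rcases (abs_eq zero_le_one).1 habs with h | h
    · exact ⟨1, Or.inl rfl, by simp [h]⟩
    · exact ⟨-1, Or.inr rfl, by simp [h]⟩
  have hcau := my_cauchy (fun j => u j / q) (fun j => v j / q)
    (fun i j h => hvi (by simpa [div_left_inj' hq] using h))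
    (fun j k h => huv j k (by simpa [div_left_inj' hq] using h))
  have hD' : (Matrix.of fun j k => (u j / q - v k / q)⁻¹).det = q ^ n * D := by
    have : (Matrix.of fun j k => (u j / q - v k / q)⁻¹) =
        q • Matrix.of fun j k => (u j - v k)⁻¹ := by
      ext j k
      simp only [Matrix.of_apply, Matrix.smul_apply, smul_eq_mul]
      rw [← sub_div, inv_div, div_eq_mul_inv]
    rw [this, Matrix.det_smul, Fintype.card_fin]
  rw [hD'] at hcau
  have hP' : ∏ k : Fin n, ((ZMod.stdAddChar (((k : ℕ) + 1 : ℕ) : ZMod p) : ℂ) / q -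
      ZMod.stdAddChar (-(((k : ℕ) + 1 : ℕ) : ZMod p)) / q) =
      (Complex.I ^ n * (Real.sqrt p : ℂ)) / q ^ n := by
    rw [← hP]
    simp only [← sub_div]
    rw [Finset.prod_div_distrib, Finset.prod_const, Finset.card_univ, Fintype.card_fin]
  have hmain : (e : ℂ) * ∏ j, ∏ k, (u j / q - v k / q) =
      (∏ i, ∏ j ∈ Finset.Ioi i, ((u j / q - u i / q) * (v i / q - v j / q))) *
      ∏ k : Fin n, ((ZMod.stdAddChar (((k : ℕ) + 1 : ℕ) : ZMod p) : ℂ) / q -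
      ZMod.stdAddChar (-(((k : ℕ) + 1 : ℕ) : ZMod p)) / q) := by
    rw [← hcau, hP']
    have : (e : ℂ) = (s : ℂ) := by rw [hse]; simp
    rw [this, hsD]
    field_simp
  have hR1 : MyRed p ((e : ℂ) * ∏ j, ∏ k, (u j / q - v k / q))
      ((e : ZMod p) * ∏ j, ∏ k, (X j - Y k)) := by
    refine (MyRed.int e).mul (MyRed.prod _ fun j _ => MyRed.prod _ fun k _ => ?_)
    rw [hu, hv]; exact MyRed.quot _ _
  have hR2 := (MyRed.prod Finset.univ fun (i : Fin n) _ =>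
      MyRed.prod (Finset.Ioi i) fun (j : Fin n) _ =>
      (MyRed.quot (X j) (X i)).mul (MyRed.quot (Y i) (Y j))).mul
    (MyRed.prod Finset.univ fun (k : Fin n) _ => MyRed.quot (((k : ℕ) + 1 : ℕ) : ZMod p)
      (-(((k : ℕ) + 1 : ℕ) : ZMod p)))
  simp only [← hu, ← hv, ← hqdef] at hR2
  rw [hmain] at hR1
  obtain ⟨hez, hw, hf⟩ := my_zmod hn hpn A B hAB X Y hX hY _ (hR1.unique hR2)
  have hcast : ((a * b : ℤ) : ZMod p) = A * B := by push_cast; rfl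
  rw [hcast]
  have hfin : e = (-1) ^ (g + 2) *
      (if (A * B) ^ (g + 1) = (n.factorial : ZMod p) then 1 else -1 : ℤ) := by
    have hz : (e : ZMod p) = (((-1) ^ (g + 2) *
      (if (A * B) ^ (g + 1) = (n.factorial : ZMod p) then 1 else -1 : ℤ) : ℤ) : ZMod p) := by
      rw [hez]
      split_ifs with h
      · push_cast
        rw [h, pow_succ _ (g + 1)]
        linear_combination ((-1 : ZMod p) ^ (g + 1)) * hf
      · have : (A * B) ^ (g + 1) = -(n.factorial : ZMod p) :=
          (sq_eq_sq_iff_eq_or_eq_neg.1 (hw.trans hf.symm)).resolve_left h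
        push_cast
        rw [this, pow_succ _ (g + 1)]
        linear_combination (-(-1 : ZMod p) ^ (g + 1)) * hf
    have hpm : ((-1) ^ (g + 2) *
      (if (A * B) ^ (g + 1) = (n.factorial : ZMod p) then 1 else -1 : ℤ) : ℤ) = 1 ∨
      ((-1) ^ (g + 2) *
      (if (A * B) ^ (g + 1) = (n.factorial : ZMod p) then 1 else -1 : ℤ) : ℤ) = -1 := by
      rcases neg_one_pow_eq_or ℤ (g + 2) with h | h <;> rw [h] <;> split_ifs <;> simp
    have h11 : (1 : ZMod p) ≠ -1 := by
      have : Fact (2 < p) := ⟨by omega⟩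
      exact (ZMod.neg_one_ne_one).symm
    rcases he with he | he <;> rcases hpm with h | h <;> rw [h] at hz ⊢ <;> rw [he] at hz ⊢
    · exact absurd (by simpa using hz) h11
    · exact absurd (by simpa using hz.symm) h11
  have hR : (e : ℝ) = (-1) ^ (g + 2) *
      ((if (A * B) ^ (g + 1) = (n.factorial : ZMod p) then 1 else -1 : ℤ) : ℝ) := by
    conv_lhs => rw [hfin]
    push_cast; rfl
  rw [← hR, ← hse, hs]
  field_simp
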